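/- Let G ≠ K_6 be a vertex-minimal critical graph with χ(G) = Δ(G) = 6 and the vertices of degree ≥ 6 forming an independent set (so G contains no K_6 - e). Let C be a K_5 clique in G with at most one high vertex (vertex of degree 6). Then every vertex of G outside C is adjacent to at most one low vertex (vertex of degree 5) in C. -/

import Mathlib

open SimpleGraph Finset

def PC {V : Type*} (G : SimpleGraph V) (k : ℕ) (S : Set V) (c : V → Fin k) : Prop :=
  ∀ u ∈ S, ∀ v ∈ S, G.Adj u v → c u ≠ c v

theorem pc_step {V : Type*} [DecidableEq V] {G : SimpleGraph V} {k : ℕ} {S : Set V} {c : V → Fin k}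
    (h : PC G k S c) (v : V) (hv : v ∉ S) (F : Finset (Fin k)) (hF : F.card < k)
    (hN : ∀ u ∈ S, G.Adj v u → c u ∈ F) :
    ∃ c', PC G k (insert v S) c' ∧ ∀ u ∈ S, c' u = c u := by
  obtain ⟨a, ha⟩ : ∃ a, a ∉ F := by
    by_contra hcon
    push Not at hcon
    have : F = Finset.univ := by ext; simp [hcon]
    rw [this] at hF
    simp at hF
  refine ⟨Function.update c v a, ?_, ?_⟩
  · intro u hu w hw huw
    rw [Set.mem_insert_iff] at hu hw
    rcases hu with rfl | hu <;> rcases hw with rfl | hw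
    · exact absurd huw (G.loopless.irrefl _)
    · have : w ≠ u := fun h => hv (h ▸ hw)
      rw [Function.update_self, Function.update_of_ne this]
      rintro rfl
      exact ha (hN w hw huw)
    · have : u ≠ w := fun h => hv (h ▸ hu)
      rw [Function.update_self, Function.update_of_ne this]
      rintro rfl
      exact ha (hN u hu huw.symm)
    · have h1 : w ≠ v := fun h => hv (h ▸ hw)
      have h2 : u ≠ v := fun h => hv (h ▸ hu)
      rw [Function.update_of_ne h1, Function.update_of_ne h2]
      exact h u hu w hw huw
  · intro u hu
    have h2 : u ≠ v := fun h => hv (h ▸ hu)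
    rw [Function.update_of_ne h2]

theorem pc_step1 {V : Type*} [Fintype V] [DecidableEq V] {G : SimpleGraph V} [DecidableRel G.Adj]
    {k : ℕ} {S : Set V} {c : V → Fin k}
    (h : PC G k S c) (v : V) (hv : v ∉ S) (hd : G.degree v ≤ k) (w : V) (hw : G.Adj v w)
    (hN : w ∉ S ∨ ∃ b, b ≠ w ∧ G.Adj v b ∧ c b = c w) :
    ∃ c', PC G k (insert v S) c' ∧ ∀ u ∈ S, c' u = c u := by
  have hwm : w ∈ G.neighborFinset v := by simpa using hw
  have hc : ((G.neighborFinset v).erase w).card < k := by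
    have := Finset.card_erase_lt_of_mem hwm
    rw [G.card_neighborFinset_eq_degree] at this
    omega
  refine pc_step h v hv (((G.neighborFinset v).erase w).image c)
    (lt_of_le_of_lt Finset.card_image_le hc) ?_
  intro u hu huv
  by_cases huw : u = w
  · subst huw
    rcases hN with hN | ⟨b, hb, hvb, hbc⟩
    · exact absurd hu hN
    · rw [← hbc]
      exact Finset.mem_image_of_mem _ (by simp [hb, hvb])
  · exact Finset.mem_image_of_mem _ (by simp [huw, huv])

theorem pc_path {V : Type*} [Fintype V] [DecidableEq V] {G : SimpleGraph V} [DecidableRel G.Adj]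
    {k : ℕ} (hd : ∀ v, G.degree v ≤ k) (z : V) (l : List V) : ∀ (S : Set V) (c : V → Fin k),
    PC G k S c → (l ++ [z]).IsChain G.Adj → (l ++ [z]).Nodup → (∀ u ∈ l ++ [z], u ∉ S) →
    ∃ c', PC G k (S ∪ {u | u ∈ l}) c' ∧ ∀ u ∈ S, c' u = c u := by
  induction l with
  | nil => intro S c h _ _ _; exact ⟨c, by simpa using h, fun _ _ => rfl⟩
  | cons a l ih =>
    intro S c h hch hnd hS
    obtain ⟨w, hw, hwl⟩ : ∃ w, w ∈ l ++ [z] ∧ G.Adj a w := by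
      cases l with
      | nil => exact ⟨z, by simp, by simpa using hch⟩
      | cons b l => exact ⟨b, by simp, by simp at hch; exact hch.1⟩
    obtain ⟨c1, h1, h1'⟩ := pc_step1 h a (hS a (by simp)) (hd a) w hwl
      (Or.inl (hS w (by simp at hw ⊢; tauto)))
    simp only [List.cons_append, List.nodup_cons] at hnd
    obtain ⟨c2, h2, h2'⟩ := ih (insert a S) c1 h1 (by exact (List.isChain_cons.1 hch).2) hnd.2 (by
      intro u hu
      rw [Set.mem_insert_iff]
      rintro (rfl | h)
      · exact hnd.1 hu
      · exact hS u (by simp at hu ⊢; tauto) h)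
    refine ⟨c2, ?_, fun u hu => by rw [h2' u (Set.mem_insert_of_mem _ hu), h1' u hu]⟩
    convert h2 using 1
    ext u
    simp
    tauto

theorem nodup_aux {V : Type*} (A B : List V) (d e : V) (h : (A ++ d :: e :: B).Nodup) :
    (A.reverse ++ B.reverse ++ [e]).Nodup ∧ d ∉ A.reverse ++ B.reverse ++ [e] ∧
      e ∉ A.reverse ++ B.reverse := by
  simp [List.nodup_append] at h ⊢
  grind

/-- Brooks for critical graphs -/
theorem brooks {V : Type*} [Fintype V] [DecidableEq V] (G : SimpleGraph V) [DecidableRel G.Adj]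
    (hd : ∀ v, G.degree v ≤ 5) (hcr : ∀ w, ∃ c, PC G 5 {w}ᶜ c)
    (hno : ∀ c, ¬ PC G 5 Set.univ c) : ∃ s, G.IsNClique 6 s := by
  have hcr' : ∀ S : Set V, S ≠ Set.univ → ∃ c, PC G 5 S c := by
    intro S hS
    obtain ⟨w, hw⟩ := (Set.ne_univ_iff_exists_notMem S).1 hS
    obtain ⟨c, hc⟩ := hcr w
    exact ⟨c, fun u hu v hv => hc u (fun h => hw (h ▸ hu)) v (fun h => hw (h ▸ hv))⟩
  have hdeg : ∀ v, 5 ≤ G.degree v := by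
    intro v
    by_contra hlt
    obtain ⟨c, hc⟩ := hcr v
    obtain ⟨c', h', -⟩ := pc_step hc v (by simp) ((G.neighborFinset v).image c)
      (lt_of_le_of_lt Finset.card_image_le (by rw [G.card_neighborFinset_eq_degree]; omega))
      (by intro u _ hu; exact Finset.mem_image_of_mem _ (by simpa using hu))
    apply hno c'
    convert h'
    ext u; simp; tauto
  by_cases hcl : ∃ x a b, G.Adj x a ∧ G.Adj x b ∧ a ≠ b ∧ ¬ G.Adj a b
  swap
  · push Not at hcl
    have : Nonempty V := by
      by_contra h
      exact hno (fun _ => 0) (fun u => absurd ⟨u⟩ h)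
    obtain ⟨x⟩ := this
    refine ⟨insert x (G.neighborFinset x), ?_, ?_⟩
    · intro u hu v hv huv
      simp only [Finset.coe_insert, Set.mem_insert_iff, Finset.mem_coe, mem_neighborFinset] at hu hv
      rcases hu with rfl | hu <;> rcases hv with rfl | hv
      · exact absurd rfl huv
      · exact hv
      · exact hu.symm
      · exact hcl x u v hu hv huv
    · rw [Finset.card_insert_of_notMem (by simp), G.card_neighborFinset_eq_degree]
      have := hd x; have := hdeg x; omega
  exfalso
  obtain ⟨x, a, b, hxa, hxb, hab, hnab⟩ := hcl
  -- maximal path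
  obtain ⟨p, hpch, hpnd, hpmax⟩ : ∃ p : List V, (p ++ [b, x, a]).IsChain G.Adj ∧
      (p ++ [b, x, a]).Nodup ∧ ∀ q : List V, (q ++ [b, x, a]).IsChain G.Adj →
      (q ++ [b, x, a]).Nodup → q.length ≤ p.length := by
    let P : ℕ → Prop := fun n => ∃ p : List V, (p ++ [b, x, a]).IsChain G.Adj ∧
      (p ++ [b, x, a]).Nodup ∧ p.length = n
    have hb : ∀ n, P n → n ≤ Fintype.card V := by
      rintro n ⟨p, -, h, rfl⟩
      exact (List.nodup_append.1 h).1.length_le_card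
    classical
    have h0 : P 0 := ⟨[], by simp [hxb.symm, hxa], by
      simp [hxb.ne', hxa.ne, hab.symm], rfl⟩
    obtain ⟨p, h1, h2, h3⟩ := Nat.findGreatest_spec (P := P) (Nat.zero_le (Fintype.card V)) h0
    refine ⟨p, h1, h2, fun q hq1 hq2 => ?_⟩
    rw [h3]
    exact Nat.le_findGreatest (hb _ ⟨q, hq1, hq2, rfl⟩) ⟨q, hq1, hq2, rfl⟩
  -- Hamiltonian case
  by_cases hall : ∀ u, u ∈ p ++ [b, x, a]
  · obtain ⟨y, hxy, hya, hyb⟩ : ∃ y, G.Adj x y ∧ y ≠ a ∧ y ≠ b := by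
      by_contra hcon
      push Not at hcon
      have hsub : G.neighborFinset x ⊆ {a, b} := by
        intro y hy
        rw [mem_neighborFinset] at hy
        have := hcon y hy
        simp; tauto
      have := Finset.card_le_card hsub
      rw [G.card_neighborFinset_eq_degree] at this
      have := hdeg x
      have := Finset.card_le_two (a := a) (b := b)
      omega
    have hyp : y ∈ p := by
      have := hall y
      have := hxy.ne'
      simp at *
      tauto
    obtain ⟨P, Q, rfl⟩ := List.append_of_mem hyp
    have h0 : PC G 5 {a, b} (fun _ => 0) := by
      intro u hu v hv huv
      simp at hu hv
      rcases hu with rfl | rfl <;> rcases hv with rfl | rfl <;>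
        first | exact absurd huv (G.loopless.irrefl _) | exact absurd huv hnab |
          exact absurd huv.symm hnab
    have hnd1 := hpnd
    simp [List.nodup_append] at hnd1
    obtain ⟨c1, h1, h1'⟩ := pc_path hd y Q.reverse {a, b} _ h0 (by
      have : (y :: Q).IsChain G.Adj := hpch.infix ⟨P, [b, x, a], by simp⟩
      rw [← List.reverse_cons]
      exact List.isChain_reverse.2 (this.imp (fun _ _ h => h.symm))) (by
      have : (y :: Q).Nodup := hpnd.sublist (List.IsInfix.sublist ⟨P, [b, x, a], by simp⟩)
      have := List.nodup_reverse.2 this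
      simpa using this) (by
      intro u hu
      simp at hu ⊢
      grind)
    obtain ⟨c2, h2, h2'⟩ := pc_path hd x (P ++ [y]) _ _ h1 (by
      have : (P ++ [y]).IsChain G.Adj := hpch.infix ⟨[], Q ++ [b, x, a], by simp⟩
      rw [List.isChain_append]
      refine ⟨this, by simp, ?_⟩
      simp [hxy.symm]) (by
      simp [List.nodup_append]
      grind) (by
      intro u hu
      simp at hu ⊢
      grind)
    obtain ⟨c3, h3, h3'⟩ := pc_step1 h2 x (by simp; grind) (hd x) a hxa (Or.inr ⟨b, hab.symm, hxb, by
      rw [h2' b (by simp), h2' a (by simp), h1' b (by simp), h1' a (by simp)]⟩)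
    apply hno c3
    convert h3
    symm
    rw [Set.eq_univ_iff_forall]
    intro u
    have := hall u
    simp at this ⊢
    tauto
  -- head of the path
  obtain ⟨r, t, hrt⟩ : ∃ r t, p ++ [b, x, a] = r :: t := by
    cases p with
    | nil => exact ⟨_, _, rfl⟩
    | cons r t => exact ⟨_, _, rfl⟩
  have hrN : ∀ u, G.Adj r u → u ∈ t := by
    intro u hu
    by_contra hut
    have := hpmax (u :: p) (by
      rw [List.cons_append, hrt, List.isChain_cons_cons, ← hrt]
      exact ⟨hu.symm, hpch⟩) (by
      rw [List.cons_append, List.nodup_cons]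
      refine ⟨?_, hpnd⟩
      rw [hrt, List.mem_cons]
      rintro (h | h)
      · exact hu.ne h.symm
      · exact hut h)
    simp at this
  rw [hrt] at hpch hpnd hall
  -- the cycle
  obtain ⟨m, j, s, hts, hrj, hout⟩ : ∃ m j s, t = m ++ j :: s ∧ G.Adj r j ∧ ∀ u, G.Adj r u → u ∈ m ++ [j] := by
    have hex : ∃ u ∈ t, G.Adj r u := by
      have h5 := hdeg r
      rw [← G.card_neighborFinset_eq_degree] at h5
      obtain ⟨u, hu⟩ := Finset.card_pos.1 (by omega : 0 < (G.neighborFinset r).card)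
      rw [mem_neighborFinset] at hu
      exact ⟨u, hrN u hu, hu⟩
    clear hrt hpch hpnd hall hpmax
    induction t using List.reverseRecOn with
    | nil => simp at hex
    | append_singleton t z ih =>
      by_cases hz : G.Adj r z
      · exact ⟨t, z, [], rfl, hz, hrN⟩
      · obtain ⟨m, j, s, rfl, h2, h3⟩ := ih (by
          intro u hu
          have := hrN u hu
          simp at this
          rcases this with h | rfl
          · exact h
          · exact absurd hu hz) (by
          obtain ⟨u, hu, hu'⟩ := hex
          simp at hu
          rcases hu with h | rfl
          · exact ⟨u, h, hu'⟩
          · exact absurd hu' hz)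
        exact ⟨m, j, s ++ [z], by simp, h2, h3⟩
  have hcch : (r :: (m ++ [j])).IsChain G.Adj := hpch.infix ⟨[], s, by simp [hts]⟩
  have hcnd : (r :: (m ++ [j])).Nodup := hpnd.sublist (List.IsInfix.sublist ⟨[], s, by simp [hts]⟩)
  set cyc := r :: (m ++ [j]) with hcyc
  have hnall : ∃ u, u ∉ cyc := by
    push Not at hall
    obtain ⟨u, hu⟩ := hall
    refine ⟨u, fun h => hu ?_⟩
    rw [hts]; simp [hcyc] at h ⊢; tauto
  -- some cycle vertex has an outside neighbour
  have hedge : ∃ y ∈ cyc, ∃ u, u ∉ cyc ∧ G.Adj y u := by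
    by_contra hcon
    push Not at hcon
    obtain ⟨c1, h1⟩ := hcr' {u | u ∈ cyc} (by
      obtain ⟨u, hu⟩ := hnall
      exact (Set.ne_univ_iff_exists_notMem _).2 ⟨u, hu⟩)
    obtain ⟨c2, h2⟩ := hcr' {u | u ∉ cyc} (by
      exact (Set.ne_univ_iff_exists_notMem _).2 ⟨r, by simp [hcyc]⟩)
    apply hno (fun u => if u ∈ cyc then c1 u else c2 u)
    intro u _ v _ huv
    by_cases hu : u ∈ cyc <;> by_cases hv : v ∈ cyc
    · simp only [hu, hv, if_true]; exact h1 u hu v hv huv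
    · exact absurd huv (hcon u hu v hv)
    · exact absurd huv.symm (hcon v hv u hu)
    · simp only [hu, hv, if_false]; exact h2 u hu v hv huv
  -- first one
  obtain ⟨A, d, e, B, hAB, hdno, u0, hu0, heu0⟩ : ∃ A d e B, cyc = A ++ d :: e :: B ∧
      (∀ u, u ∉ cyc → ¬ G.Adj d u) ∧ ∃ u, u ∉ cyc ∧ G.Adj e u := by
    have hr0 : ∀ u, u ∉ cyc → ¬ G.Adj r u := by
      intro u hu hru
      exact hu (by have := hout u hru; simp [hcyc] at this ⊢; tauto)
    have gen : ∀ (P : V → Prop) (l : List V) (r : V), ¬ P r → (∃ y ∈ r :: l, P y) →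
        ∃ A d e B, r :: l = A ++ d :: e :: B ∧ ¬ P d ∧ P e := by
      intro P l
      induction l with
      | nil => intro r hr h; simp at h; exact absurd h hr
      | cons q l ih =>
        intro r hr h
        by_cases hq : P q
        · exact ⟨[], r, q, l, rfl, hr, hq⟩
        · obtain ⟨A, d, e, B, h1, h2, h3⟩ := ih q hq (by
            obtain ⟨y, hy, hy'⟩ := h
            rcases List.mem_cons.1 hy with rfl | hy
            · exact absurd hy' hr
            · exact ⟨y, hy, hy'⟩)
          exact ⟨r :: A, d, e, B, by simp [h1], h2, h3⟩
    obtain ⟨A, d, e, B, h1, h2, h3⟩ := gen (fun y => ∃ u, u ∉ cyc ∧ G.Adj y u) (m ++ [j]) r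
      (by push Not; exact hr0) hedge
    push Not at h2
    exact ⟨A, d, e, B, h1, h2, h3⟩
  have hdmem : d ∈ cyc := by rw [hAB]; simp
  have hemem : e ∈ cyc := by rw [hAB]; simp
  obtain ⟨c0, h0⟩ := hcr' {u | u ∉ cyc} (by
      exact (Set.ne_univ_iff_exists_notMem _).2 ⟨r, by simp [hcyc]⟩)
  have h1 : PC G 5 (insert d {u | u ∉ cyc}) (Function.update c0 d (c0 u0)) := by
    intro u hu v hv huv
    rw [Set.mem_insert_iff] at hu hv
    rcases hu with rfl | hu <;> rcases hv with rfl | hv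
    · exact absurd huv (G.loopless.irrefl _)
    · exact absurd huv (hdno v hv)
    · exact absurd huv.symm (hdno u hu)
    · rw [Function.update_of_ne (by rintro rfl; exact hu hdmem),
        Function.update_of_ne (by rintro rfl; exact hv hdmem)]
      exact h0 u hu v hv huv
  have hnd := hcnd
  rw [hAB] at hnd
  obtain ⟨nd1, nd2, nd3⟩ := nodup_aux A B d e hnd
  have hlast : (e :: B).getLast? = some j := by
    have : cyc.getLast? = some j := by
      change ((r :: m) ++ [j]).getLast? = some j
      exact List.getLast?_concat
    rw [hAB] at this
    simpa using this
  have hde : G.Adj d e := by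
    have : [d, e].IsChain G.Adj := hcch.infix ⟨A, B, by rw [hAB]; simp⟩
    simpa using this
  obtain ⟨c2, h2, h2'⟩ := pc_path hd e (A.reverse ++ B.reverse) _ _ h1 (by
    rw [List.append_assoc, ← List.reverse_cons, List.isChain_append]
    have hA : A.IsChain G.Adj := hcch.infix ⟨[], d :: e :: B, by rw [hAB]; simp⟩
    have hB : (e :: B).IsChain G.Adj := hcch.infix ⟨A ++ [d], [], by rw [hAB]; simp⟩
    refine ⟨List.isChain_reverse.2 (hA.imp (fun _ _ h => h.symm)),
      List.isChain_reverse.2 (hB.imp (fun _ _ h => h.symm)), ?_⟩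
    intro u hu v hv
    rw [List.head?_reverse, hlast] at hv
    rw [List.getLast?_reverse] at hu
    have : cyc.head? = some u := by rw [hAB, List.head?_append]; simp at hu; simp [hu]
    rw [hcyc] at this
    simp at this hv
    rw [← this, ← hv]
    exact hrj) nd1 (by
    intro u hu hu'
    rw [Set.mem_insert_iff] at hu'
    rcases hu' with rfl | hu'
    · exact nd2 hu
    · apply hu'
      rw [hAB]
      simp at hu ⊢; tauto)
  have hud : u0 ≠ d := fun h => hu0 (h ▸ hdmem)
  obtain ⟨c3, h3, h3'⟩ := pc_step1 h2 e (by
    simp only [Set.mem_union, Set.mem_insert_iff, Set.mem_ofPred_eq, hemem, not_true, or_false]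
    rintro (h | h)
    · exact hde.ne h.symm
    · exact nd3 h) (hd e) u0 heu0
    (Or.inr ⟨d, hud.symm, hde.symm, by
      rw [h2' d (by simp), h2' u0 (Set.mem_insert_of_mem _ hu0)]
      rw [Function.update_self, Function.update_of_ne hud]⟩)
  apply hno c3
  convert h3
  symm
  rw [Set.eq_univ_iff_forall]
  intro u
  simp [hAB]
  tauto

theorem colorable_iff_pc {V : Type*} (G : SimpleGraph V) (k : ℕ) :
    G.Colorable k ↔ ∃ c, PC G k Set.univ c := by
  constructor
  · rintro ⟨c⟩
    exact ⟨c, fun u _ v _ h => c.valid h⟩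
  · rintro ⟨c, hc⟩
    exact ⟨Coloring.mk c (fun h => hc _ (Set.mem_univ _) _ (Set.mem_univ _) h)⟩

theorem induce_colorable_iff_pc {V : Type*} [DecidableEq V] (G : SimpleGraph V) (v : V) :
    (G.induce ({v}ᶜ : Set V)).Colorable 5 ↔ ∃ c, PC G 5 {v}ᶜ c := by
  constructor
  · rintro ⟨c⟩
    refine ⟨fun u => if h : u = v then 0 else c ⟨u, h⟩, ?_⟩
    intro u hu w hw huw
    have hu' : u ≠ v := hu
    have hw' : w ≠ v := hw
    simp only [hu', hw', dif_neg, not_false_eq_true]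
    exact c.valid (v := ⟨u, hu⟩) (w := ⟨w, hw⟩) huw
  · rintro ⟨c, hc⟩
    exact ⟨Coloring.mk (fun u => c u) (fun {u w} h => hc u u.2 w w.2 h)⟩

theorem lt_six_iff {V : Type*} (G : SimpleGraph V) :
    G.chromaticNumber < 6 ↔ G.Colorable 5 := by
  rw [← chromaticNumber_le_iff_colorable]
  exact ENat.lt_add_one_iff (m := G.chromaticNumber) (n := 5) (by exact ENat.natCast_ne_top 5)

theorem crit_clique {V : Type*} [Fintype V] [DecidableEq V] (H : SimpleGraph V)
    [DecidableRel H.Adj] (N : ℕ)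
    (hminimal : ∀ (W : Type) [Fintype W] [DecidableEq W]
      (G' : SimpleGraph W) [DecidableRel G'.Adj] (k' : ℕ),
      Fintype.card W < N →
      G'.chromaticNumber = k' →
      (∀ w : W, (G'.induce ({w}ᶜ : Set W)).chromaticNumber < G'.chromaticNumber) →
      G'.maxDegree ≤ k' → 6 ≤ G'.maxDegree →
      (∀ u w : W, k' ≤ G'.degree u → k' ≤ G'.degree w → ¬ G'.Adj u w) →
      Nonempty (G' ≃g (⊤ : SimpleGraph (Fin k'))))
    (S0 : Finset V) (hS0 : S0.card < N) (hno : ∀ c, ¬ PC H 5 (S0 : Set V) c)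
    (hdeg : ∀ u ∈ S0, (S0.filter (H.Adj u)).card ≤ 6)
    (hind : ∀ u ∈ S0, ∀ v ∈ S0, 6 ≤ (S0.filter (H.Adj u)).card →
      6 ≤ (S0.filter (H.Adj v)).card → ¬ H.Adj u v) :
    ∃ s, H.IsNClique 6 s := by
  obtain ⟨S, hSS0, hSno, hSmin⟩ : ∃ S ⊆ S0, (∀ c, ¬ PC H 5 (S : Set V) c) ∧
      ∀ w ∈ S, ∃ c, PC H 5 ((S.erase w : Finset V) : Set V) c := by
    obtain ⟨S, hS, hm⟩ := exists_minimal_le_of_wellFoundedLT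
      (fun S : Finset V => ∀ c, ¬ PC H 5 (S : Set V) c) S0 hno
    refine ⟨S, hS, hm.prop, ?_⟩
    intro w hw
    by_contra hcon
    push Not at hcon
    have := hm.le_of_le hcon (Finset.erase_subset w S) hw
    simp at this
  let e : Fin S.card ≃ S := S.equivFin.symm
  let φ : Fin S.card ↪ V := ⟨fun i => (e i : V), fun i j h => e.injective (Subtype.ext h)⟩
  have hφ : ∀ i, φ i ∈ S := fun i => (e i).2
  let G' : SimpleGraph (Fin S.card) := H.comap φ
  have hG' : ∀ i j, G'.Adj i j ↔ H.Adj (φ i) (φ j) := fun i j => Iff.rfl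
  have : DecidableRel G'.Adj := fun i j => decidable_of_iff _ (hG' i j).symm
  have hno' : ∀ c, ¬ PC G' 5 Set.univ c := by
    intro c hc
    apply hSno (fun u => if h : u ∈ S then c (e.symm ⟨u, h⟩) else 0)
    intro u hu v hv huv
    have hu' : u ∈ S := hu
    have hv' : v ∈ S := hv
    simp only [hu', hv', dif_pos]
    apply hc _ (Set.mem_univ _) _ (Set.mem_univ _)
    rw [hG']
    change H.Adj (e (e.symm ⟨u, hu'⟩) : V) (e (e.symm ⟨v, hv'⟩) : V)
    rw [e.apply_symm_apply, e.apply_symm_apply]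
    exact huv
  have hcr' : ∀ w, ∃ c, PC G' 5 {w}ᶜ c := by
    intro w
    obtain ⟨c, hc⟩ := hSmin (φ w) (hφ w)
    refine ⟨fun i => c (φ i), fun i hi j hj hij => hc _ ?_ _ ?_ hij⟩
    · have : φ i ≠ φ w := fun h => hi (φ.injective h)
      simp [this, hφ]
    · have : φ j ≠ φ w := fun h => hj (φ.injective h)
      simp [this, hφ]
  have hdle : ∀ i, G'.degree i ≤ (S0.filter (H.Adj (φ i))).card := by
    intro i
    rw [← G'.card_neighborFinset_eq_degree, ← Finset.card_map φ]
    apply Finset.card_le_card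
    intro u hu
    rw [Finset.mem_map] at hu
    obtain ⟨j, hj, rfl⟩ := hu
    rw [mem_neighborFinset] at hj
    rw [Finset.mem_filter]
    exact ⟨hSS0 (hφ j), hj⟩
  have hcl : ∃ s, G'.IsNClique 6 s := by
    by_cases h5 : ∀ i, G'.degree i ≤ 5
    · exact brooks G' h5 hcr' hno'
    push Not at h5
    obtain ⟨i, hi⟩ := h5
    have hchr : G'.chromaticNumber = (6 : ℕ) := by
      apply le_antisymm
      · rw [chromaticNumber_le_iff_colorable, colorable_iff_pc]
        obtain ⟨c, hc⟩ := hcr' i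
        refine ⟨fun j => if j = i then Fin.last 5 else (c j).castSucc, ?_⟩
        intro u _ v _ huv
        by_cases hu : u = i <;> by_cases hv : v = i
        · subst hu; subst hv; exact absurd huv (G'.loopless.irrefl _)
        · simp only [hu, hv, if_true, if_false]
          exact (Fin.castSucc_lt_last _).ne'
        · simp only [hu, hv, if_true, if_false]
          exact (Fin.castSucc_lt_last _).ne
        · simp only [hu, hv, if_false]
          intro h
          exact hc u hu v hv huv (Fin.castSucc_injective _ h)
      · by_contra hlt
        rw [not_le] at hlt
        have := (lt_six_iff G').1 hlt
        rw [colorable_iff_pc] at this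
        obtain ⟨c, hc⟩ := this
        exact hno' c hc
    obtain ⟨f⟩ := hminimal (Fin S.card) G' 6
      (by rw [Fintype.card_fin]; exact lt_of_le_of_lt (Finset.card_le_card hSS0) hS0) hchr
      (by
        intro w
        rw [hchr]
        exact (lt_six_iff _).2 ((induce_colorable_iff_pc G' w).2 (hcr' w)))
      (G'.maxDegree_le_of_forall_degree_le _ (fun j => (hdle j).trans (hdeg _ (hSS0 (hφ j)))))
      (le_trans hi (G'.degree_le_maxDegree i))
      (fun u w hu hw => hind _ (hSS0 (hφ u)) _ (hSS0 (hφ w)) (hu.trans (hdle u)) (hw.trans (hdle w)))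
    refine ⟨(Finset.univ : Finset (Fin 6)).map f.symm.toEquiv.toEmbedding, ?_, by
      rw [Finset.card_map, Finset.card_univ, Fintype.card_fin]⟩
    intro u _ v _ huv
    rw [← f.map_adj_iff]
    simp [huv]
  obtain ⟨s, hs, hs6⟩ := hcl
  refine ⟨s.map φ, ?_, by simp [hs6]⟩
  intro u hu v hv huv
  simp only [Finset.coe_map, Set.mem_image, Finset.mem_coe] at hu hv
  obtain ⟨i, hi, rfl⟩ := hu
  obtain ⟨j, hj, rfl⟩ := hv
  exact hs hi hj (fun h => huv (h ▸ rfl))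

theorem noK6e_aux {V : Type*} [DecidableEq V] (G : SimpleGraph V)
    (hNoK6e : ¬ ∃ f : Fin 6 → V, Function.Injective f ∧
        ∀ i j : Fin 6, i ≠ j → ¬(i = 0 ∧ j = 1) → ¬(i = 1 ∧ j = 0) →
          G.Adj (f i) (f j))
    (s : Finset V) (a b : V) (ha : a ∈ s) (hb : b ∈ s) (hab : a ≠ b) (hs : s.card = 6)
    (hadj : ∀ u ∈ s, ∀ v ∈ s, u ≠ v → ¬ (u = a ∧ v = b) → ¬ (u = b ∧ v = a) → G.Adj u v) :
    False := by
  apply hNoK6e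
  have ht : ((s.erase a).erase b).card = 4 := by
    rw [Finset.card_erase_of_mem (by simp [hb, hab.symm]), Finset.card_erase_of_mem ha, hs]
  let g : Fin 4 ≃ ((s.erase a).erase b : Finset V) := (Finset.equivFinOfCardEq ht).symm
  have hg : ∀ i, (g i : V) ≠ a ∧ (g i : V) ≠ b ∧ (g i : V) ∈ s := by
    intro i
    have := (g i).2
    simp only [Finset.mem_erase] at this
    tauto
  let f : Fin 6 → V := Fin.cons a (Fin.cons b (fun i : Fin 4 => (g i : V)))
  have hinj : Function.Injective f := by
    rw [Fin.cons_injective_iff, Fin.cons_injective_iff]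
    refine ⟨?_, ?_, fun i j h => g.injective (Subtype.ext h)⟩
    · rintro ⟨i, hi⟩
      revert hi
      refine Fin.cases ?_ (fun i => ?_) i
      · intro h; exact hab h.symm
      · intro h; exact (hg i).1 h
    · rintro ⟨i, hi⟩
      exact (hg i).2.1 hi
  have hmem : ∀ i, f i ∈ s := by
    intro i
    refine Fin.cases ha (fun i => ?_) i
    refine Fin.cases hb (fun i => ?_) i
    exact (hg i).2.2
  refine ⟨f, hinj, fun i j hij h01 h10 => hadj _ (hmem i) _ (hmem j) (hinj.ne hij) ?_ ?_⟩
  · rintro ⟨h1, h2⟩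
    exact h01 ⟨hinj (h1.trans rfl : f i = f 0), hinj (h2.trans rfl : f j = f 1)⟩
  · rintro ⟨h1, h2⟩
    exact h10 ⟨hinj (h1.trans rfl : f i = f 1), hinj (h2.trans rfl : f j = f 0)⟩

/-- Let `G ≠ K_6` be a vertex-minimal critical graph with `χ(G) = Δ(G) = 6`
and the vertices of degree at least `6` independent (so `G` has no `K_6 - e`).
If `C` is a `K_5` clique in `G` with at most one high vertex, then each vertex
outside `C` is adjacent to at most one low vertex of `C`. -/
theorem stmt_5 {V : Type*} [Fintype V] [DecidableEq V] (G : SimpleGraph V)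
    [DecidableRel G.Adj]
    (hk : G.chromaticNumber = 6) (hΔ : G.maxDegree = 6)
    (hcrit : ∀ v : V, (G.induce ({v}ᶜ : Set V)).chromaticNumber < G.chromaticNumber)
    (hind : ∀ u v : V, 6 ≤ G.degree u → 6 ≤ G.degree v → ¬ G.Adj u v)
    (hne : IsEmpty (G ≃g (⊤ : SimpleGraph (Fin 6))))
    -- minimality: every graph on fewer vertices which is critical with
    -- `χ ≥ Δ ≥ 6` and the high vertices independent is complete
    (hminimal : ∀ (W : Type) [Fintype W] [DecidableEq W]
      (G' : SimpleGraph W) [DecidableRel G'.Adj] (k' : ℕ),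
      Fintype.card W < Fintype.card V →
      G'.chromaticNumber = k' →
      (∀ w : W, (G'.induce ({w}ᶜ : Set W)).chromaticNumber < G'.chromaticNumber) →
      G'.maxDegree ≤ k' → 6 ≤ G'.maxDegree →
      (∀ u w : W, k' ≤ G'.degree u → k' ≤ G'.degree w → ¬ G'.Adj u w) →
      Nonempty (G' ≃g (⊤ : SimpleGraph (Fin k'))))
    -- `G` contains no `K_6 - e`
    (hNoK6e : ¬ ∃ f : Fin 6 → V, Function.Injective f ∧
        ∀ i j : Fin 6, i ≠ j → ¬(i = 0 ∧ j = 1) → ¬(i = 1 ∧ j = 0) →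
          G.Adj (f i) (f j))
    (C : Finset V) (hC : G.IsNClique 5 C)
    (hhigh : (C.filter fun v => G.degree v = 6).card ≤ 1) :
    ∀ v : V, v ∉ C → (C.filter fun u => G.degree u = 5 ∧ G.Adj v u).card ≤ 1 := by
  intro v hv
  by_contra hcon
  rw [not_le, Finset.one_lt_card] at hcon
  obtain ⟨x, hx, y, hy, hxy⟩ := hcon
  simp only [Finset.mem_filter] at hx hy
  obtain ⟨hxC, hx5, hvx⟩ := hx
  obtain ⟨hyC, hy5, hvy⟩ := hy
  have hnoc : ∀ c, ¬ PC G 5 Set.univ c := by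
    intro c hc
    have := (lt_six_iff G).2 ((colorable_iff_pc G 5).2 ⟨c, hc⟩)
    rw [hk] at this
    exact lt_irrefl _ this
  have hcr : ∀ w, ∃ c, PC G 5 {w}ᶜ c := by
    intro w
    have := hcrit w
    rw [hk] at this
    exact (induce_colorable_iff_pc G w).1 ((lt_six_iff _).1 this)
  have hd6 : ∀ u, G.degree u ≤ 6 := fun u => hΔ ▸ G.degree_le_maxDegree u
  have hd5 : ∀ u, 5 ≤ G.degree u := by
    intro u
    by_contra hlt
    obtain ⟨c, hc⟩ := hcr u
    obtain ⟨c', h', -⟩ := pc_step hc u (by simp) ((G.neighborFinset u).image c)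
      (lt_of_le_of_lt Finset.card_image_le (by rw [G.card_neighborFinset_eq_degree]; omega))
      (by intro t _ ht; exact Finset.mem_image_of_mem _ (by simpa using ht))
    apply hnoc c'
    convert h'
    ext t; simp; tauto
  have hCadj : ∀ u ∈ C, ∀ t ∈ C, u ≠ t → G.Adj u t := fun u hu t ht h => hC.1 hu ht h
  obtain ⟨z, hzC, hz5, hvz⟩ : ∃ z ∈ C, G.degree z = 5 ∧ ¬ G.Adj v z := by
    by_contra hall
    push Not at hall
    obtain ⟨b, hbC, hb⟩ : ∃ b ∈ C, ∀ u ∈ C, u ≠ b → G.Adj v u := by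
      by_cases hh : ∃ u ∈ C, G.degree u = 6
      · obtain ⟨b, hbC, hb6⟩ := hh
        refine ⟨b, hbC, fun u hu hub => hall u hu ?_⟩
        by_contra h5
        have h6 : G.degree u = 6 := by have := hd5 u; have := hd6 u; omega
        exact hub (Finset.card_le_one.1 hhigh u (by simp [hu, h6]) b (by simp [hbC, hb6]))
      · push Not at hh
        refine ⟨x, hxC, fun u hu _ => hall u hu ?_⟩
        have := hd5 u; have := hd6 u; have := hh u hu; omega
    refine noK6e_aux G hNoK6e (insert v C) v b (by simp) (by simp [hbC])
      (by rintro rfl; exact hv hbC) (by rw [Finset.card_insert_of_notMem hv, hC.2]) ?_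
    intro u hu t ht hut h1 h2
    rw [Finset.mem_insert] at hu ht
    rcases hu with rfl | hu <;> rcases ht with rfl | ht
    · exact absurd rfl hut
    · exact hb t ht (fun h => h1 ⟨rfl, h⟩)
    · exact (hb u hu (fun h => h2 ⟨h, rfl⟩)).symm
    · exact hCadj u hu t ht hut
  have hout : ∀ u ∈ C, G.degree u = 5 → ∃ w, ∀ t, (t ∉ C ∧ G.Adj u t) ↔ t = w := by
    intro u hu hu5
    have hsub : C.erase u ⊆ G.neighborFinset u := by
      intro t ht
      rw [Finset.mem_erase] at ht
      rw [mem_neighborFinset]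
      exact hCadj u hu t ht.2 ht.1.symm
    have hcard : (G.neighborFinset u \ C.erase u).card = 1 := by
      rw [Finset.card_sdiff_of_subset hsub, G.card_neighborFinset_eq_degree, hu5,
        Finset.card_erase_of_mem hu, hC.2]
    obtain ⟨w, hw⟩ := Finset.card_eq_one.1 hcard
    refine ⟨w, fun t => ?_⟩
    rw [← Finset.mem_singleton, ← hw, Finset.mem_sdiff, Finset.mem_erase, mem_neighborFinset]
    constructor
    · rintro ⟨h1, h2⟩; exact ⟨h2, fun h => h1 h.2⟩
    · rintro ⟨h1, h2⟩; exact ⟨fun h => h2 ⟨h1.ne', h⟩, h1⟩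
  obtain ⟨w, hw⟩ := hout z hzC hz5
  obtain ⟨hwC, hzw⟩ := (hw w).2 rfl
  have hxv : ∀ t, t ∉ C → G.Adj x t → t = v := by
    obtain ⟨w', hw'⟩ := hout x hxC hx5
    intro t ht hxt
    rw [(hw' t).1 ⟨ht, hxt⟩, (hw' v).1 ⟨hv, hvx.symm⟩]
  have hwv : w ≠ v := by rintro rfl; exact hvz hzw.symm
  have hxz : x ≠ z := by rintro rfl; exact hvz hvx
  have hyz : y ≠ z := by rintro rfl; exact hvz hvy
  -- the key recolouring
  have key : ∀ c, PC G 5 ((C : Set V)ᶜ) c → c v = c w := by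
    intro c hc
    by_contra hne'
    have h1 : PC G 5 (insert x ((C : Set V)ᶜ)) (Function.update c x (c w)) := by
      intro u hu t ht hut
      rw [Set.mem_insert_iff] at hu ht
      rcases hu with rfl | hu <;> rcases ht with rfl | ht
      · exact absurd hut (G.loopless.irrefl _)
      · have : t = v := hxv t ht hut
        subst this
        rw [Function.update_self, Function.update_of_ne (by rintro rfl; exact ht hxC)]
        exact fun h => hne' h.symm
      · have : u = v := hxv u hu hut.symm
        subst this
        rw [Function.update_self, Function.update_of_ne (by rintro rfl; exact hu hxC)]
        exact hne'
      · rw [Function.update_of_ne (by rintro rfl; exact hu hxC),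
          Function.update_of_ne (by rintro rfl; exact ht hxC)]
        exact hc u hu t ht hut
    obtain ⟨p, q, hpq, hpqC⟩ : ∃ p q, p ≠ q ∧ ((C.erase x).erase y).erase z = {p, q} := by
      apply Finset.card_eq_two.1
      rw [Finset.card_erase_of_mem (by simp [hzC, hyz.symm, hxz.symm]),
        Finset.card_erase_of_mem (by simp [hyC, hxy.symm]), Finset.card_erase_of_mem hxC, hC.2]
    have hmem : ∀ u, (u ≠ z ∧ u ≠ y ∧ u ≠ x ∧ u ∈ C) ↔ (u = p ∨ u = q) := by
      intro u
      have : u ∈ ((C.erase x).erase y).erase z ↔ u ∈ ({p, q} : Finset V) := by rw [hpqC]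
      simpa using this
    obtain ⟨hpz, hpy, hpx, hpC⟩ := (hmem p).2 (Or.inl rfl)
    obtain ⟨hqz, hqy, hqx, hqC⟩ := (hmem q).2 (Or.inr rfl)
    have stepC : ∀ (u : V) (S : Set V) (c : V → Fin 5), u ∈ C → u ≠ y → u ≠ z → u ∉ S → y ∉ S →
        z ∉ S → PC G 5 S c → ∃ c', PC G 5 (insert u S) c' ∧ ∀ t ∈ S, c' t = c t := by
      intro u S c huC huy huz huS hyS hzS hc
      refine pc_step hc u huS ((((G.neighborFinset u).erase y).erase z).image c)
        (lt_of_le_of_lt Finset.card_image_le ?_) ?_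
      · have h1 : y ∈ G.neighborFinset u := by
          rw [mem_neighborFinset]; exact hCadj u huC y hyC huy
        have h2 : z ∈ (G.neighborFinset u).erase y := by
          rw [Finset.mem_erase, mem_neighborFinset]
          exact ⟨hyz.symm, hCadj u huC z hzC huz⟩
        rw [Finset.card_erase_of_mem h2, Finset.card_erase_of_mem h1,
          G.card_neighborFinset_eq_degree]
        have := hd6 u
        omega
      · intro t ht hut
        apply Finset.mem_image_of_mem
        rw [Finset.mem_erase, Finset.mem_erase, mem_neighborFinset]
        exact ⟨by rintro rfl; exact hzS ht, by rintro rfl; exact hyS ht, hut⟩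
    obtain ⟨c2, h2, h2'⟩ := stepC p _ _ hpC hpy hpz (by simp [hpC, hpx])
      (by simp [hyC, hxy.symm]) (by simp [hzC, hxz.symm]) h1
    obtain ⟨c3, h3, h3'⟩ := stepC q _ _ hqC hqy hqz (by simp [hqC, hqx, hpq.symm])
      (by simp [hyC, hxy.symm, hpy.symm]) (by simp [hzC, hxz.symm, hpz.symm]) h2
    obtain ⟨c4, h4, h4'⟩ := pc_step1 h3 y (by simp [hyC, hxy.symm, hpy.symm, hqy.symm]) hy5.le z
      (hCadj y hyC z hzC hyz) (Or.inl (by simp [hzC, hxz.symm, hpz.symm, hqz.symm]))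
    have hxw : x ≠ w := by rintro rfl; exact hwC hxC
    obtain ⟨c5, h5, -⟩ := pc_step1 h4 z (by simp [hzC, hxz.symm, hpz.symm, hqz.symm, hyz.symm])
      hz5.le w hzw (Or.inr ⟨x, hxw, hCadj z hzC x hxC hxz.symm, by
        rw [h4' x (by simp), h4' w (by simp [hwC]), h3' x (by simp), h3' w (by simp [hwC]),
          h2' x (by simp), h2' w (by simp [hwC]), Function.update_self,
          Function.update_of_ne hxw.symm]⟩)
    apply hnoc c5
    convert h5
    symm
    rw [Set.eq_univ_iff_forall]
    intro u
    have := hmem u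
    simp
    tauto
  -- the smaller graph
  classical
  let H : SimpleGraph V := G ⊔ edge v w
  have hH : ∀ u t, H.Adj u t ↔ G.Adj u t ∨ (u = v ∧ t = w) ∨ (u = w ∧ t = v) := by
    intro u t
    simp only [H, sup_adj, edge_adj]
    constructor
    · rintro (h | ⟨h, -⟩)
      · exact Or.inl h
      · tauto
    · rintro (h | ⟨rfl, rfl⟩ | ⟨rfl, rfl⟩)
      · exact Or.inl h
      · exact Or.inr ⟨by simp, hwv.symm⟩
      · exact Or.inr ⟨by simp, hwv⟩
  have hHv : ((Finset.univ \ C).filter (H.Adj v)).card ≤ 5 := by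
    have hsub : (Finset.univ \ C).filter (H.Adj v) ⊆
        insert w (((G.neighborFinset v).erase x).erase y) := by
      intro t ht
      simp only [Finset.mem_filter, Finset.mem_sdiff, Finset.mem_univ, true_and, hH] at ht
      simp only [Finset.mem_insert, Finset.mem_erase, mem_neighborFinset]
      obtain ⟨htC, h | h | h⟩ := ht
      · exact Or.inr ⟨by rintro rfl; exact htC hyC, by rintro rfl; exact htC hxC, h⟩
      · exact Or.inl h
      · exact absurd h.1.symm hwv
    refine (Finset.card_le_card hsub).trans ((Finset.card_insert_le _ _).trans ?_)
    rw [Finset.card_erase_of_mem (by simp [hxy.symm, hvy]), Finset.card_erase_of_mem (by simp [hvx]),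
      G.card_neighborFinset_eq_degree]
    have := hd6 v
    omega
  have hHu : ∀ u, ((Finset.univ \ C).filter (H.Adj u)).card ≤ G.degree u := by
    intro u
    by_cases huv : u = v
    · subst huv
      exact hHv.trans (hd5 _)
    by_cases huw : u = w
    · subst huw
      have hsub : (Finset.univ \ C).filter (H.Adj u) ⊆ insert v ((G.neighborFinset u).erase z) := by
        intro t ht
        simp only [Finset.mem_filter, Finset.mem_sdiff, Finset.mem_univ, true_and, hH] at ht
        simp only [Finset.mem_insert, Finset.mem_erase, mem_neighborFinset]
        obtain ⟨htC, h | h | h⟩ := ht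
        · exact Or.inr ⟨by rintro rfl; exact htC hzC, h⟩
        · exact absurd h.1 huv
        · exact Or.inl h
      refine (Finset.card_le_card hsub).trans ((Finset.card_insert_le _ _).trans ?_)
      rw [Finset.card_erase_of_mem (by simp [hzw.symm]), G.card_neighborFinset_eq_degree]
      have := hd5 u
      omega
    · rw [← G.card_neighborFinset_eq_degree]
      apply Finset.card_le_card
      intro t ht
      simp only [Finset.mem_filter, hH] at ht
      rw [mem_neighborFinset]
      tauto
  obtain ⟨s, hs, hs6⟩ := crit_clique H (Fintype.card V) hminimal (Finset.univ \ C)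
    (by
      apply Finset.card_lt_univ_of_notMem (x := x)
      simp [hxC])
    (by
      intro c hc
      have hcG : PC G 5 ((C : Set V)ᶜ) c := fun u hu t ht hut =>
        hc u (by simpa using hu) t (by simpa using ht) ((hH u t).2 (Or.inl hut))
      exact hc v (by simpa using hv) w (by simpa using hwC)
        ((hH v w).2 (Or.inr (Or.inl ⟨rfl, rfl⟩))) (key c hcG))
    (fun u _ => (hHu u).trans (hd6 u))
    (by
      intro u _ t _ hu6 ht6 hut
      rcases (hH u t).1 hut with h | h | h
      · exact hind u t (hu6.trans (hHu u)) (ht6.trans (hHu t)) h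
      · rw [h.1] at hu6; omega
      · rw [h.2] at ht6; omega)
  by_cases hvw : v ∈ s ∧ w ∈ s
  · refine noK6e_aux G hNoK6e s v w hvw.1 hvw.2 hwv.symm hs6 ?_
    intro u hu t ht hut h1 h2
    rcases (hH u t).1 (hs hu ht hut) with h | h | h
    · exact h
    · exact absurd h h1
    · exact absurd h h2
  · obtain ⟨a, ha, b, hb, hab⟩ := Finset.one_lt_card.1 (by omega : 1 < s.card)
    refine noK6e_aux G hNoK6e s a b ha hb hab hs6 ?_
    intro u hu t ht hut _ _
    rcases (hH u t).1 (hs hu ht hut) with h | ⟨rfl, rfl⟩ | ⟨rfl, rfl⟩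
    · exact h
    · exact absurd ⟨hu, ht⟩ hvw
    · exact absurd ⟨ht, hu⟩ hvw
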